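/- For every natural number p ≥ 1 there exists a constant C > 0, depending only on p, such that for every h > 0 and every function v : ℝ² → ℝ that is continuously differentiable on a neighborhood of the closed square [0,h]² and satisfies ∫_{(0,h)²} v dx dy = 0, the following holds. Let v̂ be the unique bivariate polynomial of total degree ≤ p − 2 satisfying ∫_{(0,h)²} (v − v̂) m dx dy = 0 for every bivariate polynomial m of total degree ≤ p − 2 (with v̂ = 0 when p = 1). Then h⁻¹ ∫_{∂((0,h)²)} v² dμ + h⁻² ∫_{(0,h)²} v̂² dx dy ≤ C ∫_{(0,h)²} |∇v|² dx dy, where the boundary integral is taken with respect to the one-dimensional Hausdorff (arclength) measure μ on the boundary of the square. -/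

import Mathlib

open MeasureTheory

/-- The space of bivariate real polynomials of total degree at most `k`, for an
integer `k` (so that `k < 0` gives the zero space, e.g. `P₋₁ = {0}`). -/
def polyLE (k : ℤ) : Set (MvPolynomial (Fin 2) ℝ) :=
  {m | m = 0 ∨ (0 ≤ k ∧ (m.totalDegree : ℤ) ≤ k)}

/-- Evaluation of a bivariate polynomial at a point of `ℝ × ℝ`. -/
noncomputable def evP (q : MvPolynomial (Fin 2) ℝ) (z : ℝ × ℝ) : ℝ :=
  MvPolynomial.eval ![z.1, z.2] q

/-- Squared Euclidean norm of the gradient of a function of two real variables. -/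
noncomputable def gradSq2 (v : ℝ × ℝ → ℝ) (p : ℝ × ℝ) : ℝ :=
  (deriv (fun x => v (x, p.2)) p.1) ^ 2 + (deriv (fun y => v (p.1, y)) p.2) ^ 2

noncomputable abbrev MM (h : ℝ) : Measure ℝ := volume.restrict (Set.Ioo (0 : ℝ) h)

lemma MM_real (h : ℝ) (hh : 0 < h) : (MM h).real Set.univ = h := by
  simp [MM, Measure.real, hh.le]

lemma MM_prod (h : ℝ) : (MM h).prod (MM h)
    = (volume : Measure (ℝ × ℝ)).restrict (Set.Ioo (0 : ℝ) h ×ˢ Set.Ioo (0 : ℝ) h) := by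
  rw [Measure.prod_restrict]; rfl

lemma int1 {h : ℝ} {f : ℝ → ℝ} (hf : ContinuousOn f (Set.Icc 0 h)) : Integrable f (MM h) :=
  (hf.integrableOn_compact isCompact_Icc).mono_set Set.Ioo_subset_Icc_self

lemma int2 {h : ℝ} {f : ℝ × ℝ → ℝ} (hf : ContinuousOn f (Set.Icc 0 h ×ˢ Set.Icc 0 h)) :
    Integrable f ((MM h).prod (MM h)) := by
  rw [MM_prod]
  exact (hf.integrableOn_compact (isCompact_Icc.prod isCompact_Icc)).mono_set
    (Set.prod_mono Set.Ioo_subset_Icc_self Set.Ioo_subset_Icc_self)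

lemma cs1 {h : ℝ} (hh : 0 < h) {g : ℝ → ℝ} (hg : ContinuousOn g (Set.Icc 0 h)) :
    (∫ t, |g t| ∂(MM h)) ^ 2 ≤ h * ∫ t, g t ^ 2 ∂(MM h) := by
  set S := ∫ t, |g t| ∂(MM h) with hS
  have i1 : Integrable (fun t => |g t|) (MM h) := int1 hg.abs
  have i2 : Integrable (fun t => g t ^ 2) (MM h) := int1 (hg.pow 2)
  have key : 0 ≤ ∫ t, (h ^ 2 * g t ^ 2 - 2 * h * S * |g t| + S ^ 2) ∂(MM h) := by
    apply integral_nonneg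
    intro t
    have : h ^ 2 * g t ^ 2 - 2 * h * S * |g t| + S ^ 2 = (h * |g t| - S) ^ 2 := by
      rw [← sq_abs (g t)]; ring
    simp only [Pi.zero_apply]
    rw [this]; positivity
  have i12 : Integrable (fun t => h ^ 2 * g t ^ 2 - 2 * h * S * |g t|) (MM h) :=
    (i2.const_mul _).sub (i1.const_mul _)
  rw [integral_add i12 (integrable_const _),
    integral_sub (i2.const_mul _) (i1.const_mul _), integral_const_mul, integral_const_mul,
    integral_const, MM_real h hh, ← hS, smul_eq_mul] at key
  have : 0 ≤ h * (h * (∫ t, g t ^ 2 ∂(MM h)) - S ^ 2) := by nlinarith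
  have := nonneg_of_mul_nonneg_right this hh
  linarith

lemma oneD {h : ℝ} (hh : 0 < h) {f g : ℝ → ℝ} (hg : ContinuousOn g (Set.Icc 0 h))
    (hd : ∀ t ∈ Set.Icc 0 h, HasDerivAt f (g t) t) {a b : ℝ} (ha : a ∈ Set.Icc 0 h)
    (hb : b ∈ Set.Icc 0 h) : (f a - f b) ^ 2 ≤ h * ∫ t, g t ^ 2 ∂(MM h) := by
  have hsub : Set.uIcc b a ⊆ Set.Icc 0 h := Set.uIcc_subset_Icc hb ha
  have h1 : ∫ y in b..a, g y = f a - f b :=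
    intervalIntegral.integral_eq_sub_of_hasDerivAt (fun x hx => hd x (hsub hx))
      (hg.mono hsub).intervalIntegrable
  have h2 : |f a - f b| ≤ ∫ t, |g t| ∂(MM h) := by
    rw [← h1]
    refine (intervalIntegral.norm_integral_le_integral_norm_uIoc (f := g) (μ := volume)).trans ?_
    rw [MM, ← integral_Icc_eq_integral_Ioo]
    apply setIntegral_mono_set
    · exact (hg.abs.integrableOn_compact isCompact_Icc)
    · exact Filter.Eventually.of_forall fun t => abs_nonneg _
    · exact (Set.uIoc_subset_uIcc.trans hsub).eventuallyLE
  refine le_trans ?_ (cs1 hh hg)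
  rw [← sq_abs]
  gcongr

/-- data of a C¹ function on the closed square -/
structure Dat (h : ℝ) (v gx gy : ℝ × ℝ → ℝ) : Prop where
  hh : 0 < h
  cv : ContinuousOn v (Set.Icc 0 h ×ˢ Set.Icc 0 h)
  cx : ContinuousOn gx (Set.Icc 0 h ×ˢ Set.Icc 0 h)
  cy : ContinuousOn gy (Set.Icc 0 h ×ˢ Set.Icc 0 h)
  dx : ∀ x ∈ Set.Icc 0 h, ∀ y ∈ Set.Icc 0 h, HasDerivAt (fun t => v (t, y)) (gx (x, y)) x
  dy : ∀ x ∈ Set.Icc 0 h, ∀ y ∈ Set.Icc 0 h, HasDerivAt (fun t => v (x, t)) (gy (x, y)) y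
  mean : ∫ z, v z ∂((MM h).prod (MM h)) = 0

lemma sliceX {h y : ℝ} {f : ℝ × ℝ → ℝ} (hf : ContinuousOn f (Set.Icc 0 h ×ˢ Set.Icc 0 h))
    (hy : y ∈ Set.Icc 0 h) : ContinuousOn (fun x => f (x, y)) (Set.Icc 0 h) :=
  hf.comp (by fun_prop) (fun _ hx => ⟨hx, hy⟩)

lemma sliceY {h x : ℝ} {f : ℝ × ℝ → ℝ} (hf : ContinuousOn f (Set.Icc 0 h ×ˢ Set.Icc 0 h))
    (hx : x ∈ Set.Icc 0 h) : ContinuousOn (fun y => f (x, y)) (Set.Icc 0 h) :=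
  hf.comp (by fun_prop) (fun _ hy => ⟨hx, hy⟩)

lemma swapOn {h : ℝ} {f : ℝ × ℝ → ℝ} (hf : ContinuousOn f (Set.Icc 0 h ×ˢ Set.Icc 0 h)) :
    ContinuousOn (fun z : ℝ × ℝ => f z.swap) (Set.Icc 0 h ×ˢ Set.Icc 0 h) :=
  hf.comp (by fun_prop) (fun _ hz => ⟨hz.2, hz.1⟩)

lemma Dat.swap {h : ℝ} {v gx gy : ℝ × ℝ → ℝ} (D : Dat h v gx gy) :
    Dat h (fun z => v z.swap) (fun z => gy z.swap) (fun z => gx z.swap) where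
  hh := D.hh
  cv := swapOn D.cv
  cx := swapOn D.cy
  cy := swapOn D.cx
  dx := fun x hx y hy => D.dy y hy x hx
  dy := fun x hx y hy => D.dx y hy x hx
  mean := by rw [integral_prod_swap]; exact D.mean

lemma Dat.pt {h : ℝ} {v gx gy : ℝ × ℝ → ℝ} (D : Dat h v gx gy) {x y : ℝ}
    (hx : x ∈ Set.Icc 0 h) (hy : y ∈ Set.Icc 0 h) :
    v (x, y) ^ 2 ≤ 2 * h * (∫ t, gy (x, t) ^ 2 ∂(MM h))
      + 2 * ∫ z, gx z ^ 2 ∂((MM h).prod (MM h)) := by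
  have hh := D.hh
  set B := ∫ t, gy (x, t) ^ 2 ∂(MM h) with hB
  set Gx := ∫ z, gx z ^ 2 ∂((MM h).prod (MM h)) with hGx
  set c := v (x, y) with hc
  have iv := int2 D.cv
  have iv2 : Integrable (fun z => v z ^ 2) ((MM h).prod (MM h)) := int2 (D.cv.pow 2)
  have ix2 : Integrable (fun z => gx z ^ 2) ((MM h).prod (MM h)) := int2 (D.cx.pow 2)
  have iA : Integrable (fun b => ∫ s, gx (s, b) ^ 2 ∂(MM h)) (MM h) := ix2.integral_prod_right
  have hGA : ∫ b, (∫ s, gx (s, b) ^ 2 ∂(MM h)) ∂(MM h) = Gx :=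
    (integral_prod_symm _ ix2).symm
  have key : ∫ z, (c ^ 2 - 2 * c * v z + v z ^ 2) ∂((MM h).prod (MM h)) ≤
      ∫ z : ℝ × ℝ, (2 * h * B + 2 * h * (∫ s, gx (s, z.2) ^ 2 ∂(MM h)))
        ∂((MM h).prod (MM h)) := by
    apply integral_mono_ae
    · exact ((integrable_const _).sub (iv.const_mul _)).add iv2
    · exact (integrable_const _).add ((iA.comp_snd (MM h)).const_mul _)
    · rw [MM_prod]
      refine (ae_restrict_iff' (measurableSet_Ioo.prod measurableSet_Ioo)).2
        (Filter.Eventually.of_forall ?_)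
      rintro ⟨a, b⟩ ⟨ha, hb⟩
      have ha := Set.Ioo_subset_Icc_self ha
      have hb := Set.Ioo_subset_Icc_self hb
      have e1 := oneD hh (sliceY D.cy hx) (D.dy x hx) hy hb
      have e2 := oneD hh (sliceX D.cx hb) (fun t ht => D.dx t ht b hb) hx ha
      simp only at e1 e2 ⊢
      rw [← hc, ← hB] at e1
      nlinarith [sq_nonneg ((c - v (x, b)) - (v (x, b) - v (a, b)))]
  have icv : Integrable (fun z => c ^ 2 - 2 * c * v z) ((MM h).prod (MM h)) :=
    (integrable_const _).sub (iv.const_mul _)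
  rw [integral_add icv iv2,
    integral_sub (integrable_const _) (iv.const_mul _), integral_const_mul, D.mean,
    integral_add (integrable_const _) ((iA.comp_snd (MM h)).const_mul _),
    integral_const_mul, integral_const_mul, integral_fun_snd (fun b => ∫ s, gx (s, b) ^ 2 ∂(MM h)), hGA,
    integral_const, integral_const, MM_real h hh] at key
  have hvol : ((MM h).prod (MM h)).real Set.univ = h * h := by
    rw [← Set.univ_prod_univ, measureReal_prod_prod, MM_real h hh]
  rw [hvol] at key
  simp only [smul_eq_mul] at key
  have hp : 0 ≤ ∫ z, v z ^ 2 ∂((MM h).prod (MM h)) := integral_nonneg fun z => sq_nonneg _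
  have : 0 ≤ (h * h) * (2 * h * B + 2 * Gx - c ^ 2) := by nlinarith
  have := nonneg_of_mul_nonneg_right this (by positivity)
  linarith

lemma Dat.edge {h : ℝ} {v gx gy : ℝ × ℝ → ℝ} (D : Dat h v gx gy) {y : ℝ}
    (hy : y ∈ Set.Icc 0 h) :
    ∫ x, v (x, y) ^ 2 ∂(MM h) ≤ 2 * h * ((∫ z, gx z ^ 2 ∂((MM h).prod (MM h)))
      + ∫ z, gy z ^ 2 ∂((MM h).prod (MM h))) := by
  have iy2 : Integrable (fun z => gy z ^ 2) ((MM h).prod (MM h)) := int2 (D.cy.pow 2)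
  have iB : Integrable (fun x => ∫ t, gy (x, t) ^ 2 ∂(MM h)) (MM h) := iy2.integral_prod_left
  have hGB : ∫ x, (∫ t, gy (x, t) ^ 2 ∂(MM h)) ∂(MM h) = ∫ z, gy z ^ 2 ∂((MM h).prod (MM h)) :=
    (integral_prod _ iy2).symm
  have key : ∫ x, v (x, y) ^ 2 ∂(MM h) ≤ ∫ x, (2 * h * (∫ t, gy (x, t) ^ 2 ∂(MM h))
      + 2 * ∫ z, gx z ^ 2 ∂((MM h).prod (MM h))) ∂(MM h) := by
    apply integral_mono_ae
    · exact int1 ((sliceX D.cv hy).pow 2)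
    · exact (iB.const_mul _).add (integrable_const _)
    · refine (ae_restrict_iff' measurableSet_Ioo).2 (Filter.Eventually.of_forall ?_)
      intro x hx
      exact D.pt (Set.Ioo_subset_Icc_self hx) hy
  rw [integral_add (iB.const_mul _) (integrable_const _), integral_const_mul, hGB,
    integral_const, MM_real h D.hh, smul_eq_mul] at key
  linarith

lemma Dat.area {h : ℝ} {v gx gy : ℝ × ℝ → ℝ} (D : Dat h v gx gy) :
    ∫ z, v z ^ 2 ∂((MM h).prod (MM h)) ≤ 2 * h ^ 2 * ((∫ z, gx z ^ 2 ∂((MM h).prod (MM h)))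
      + ∫ z, gy z ^ 2 ∂((MM h).prod (MM h))) := by
  have iv2 : Integrable (fun z => v z ^ 2) ((MM h).prod (MM h)) := int2 (D.cv.pow 2)
  rw [integral_prod_symm _ iv2]
  have key : ∫ y, (∫ x, v (x, y) ^ 2 ∂(MM h)) ∂(MM h) ≤
      ∫ _y, (2 * h * ((∫ z, gx z ^ 2 ∂((MM h).prod (MM h)))
      + ∫ z, gy z ^ 2 ∂((MM h).prod (MM h)))) ∂(MM h) := by
    apply integral_mono_ae
    · exact iv2.integral_prod_right
    · exact integrable_const _
    · refine (ae_restrict_iff' measurableSet_Ioo).2 (Filter.Eventually.of_forall ?_)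
      intro y hy
      exact D.edge (Set.Ioo_subset_Icc_self hy)
  rw [integral_const, MM_real h D.hh, smul_eq_mul] at key
  refine key.trans (le_of_eq (by ring))

lemma haus_seg {e : ℝ → ℝ × ℝ} (he : Isometry e) (h : ℝ) :
    (μH[1] : Measure (ℝ × ℝ)).restrict (e '' Set.Icc 0 h)
      = Measure.map e (volume.restrict (Set.Icc 0 h)) := by
  have hm : MeasurableEmbedding e := he.isClosedEmbedding.measurableEmbedding
  have h1 := he.map_hausdorffMeasure (d := 1) (Or.inl zero_le_one)
  rw [hausdorffMeasure_real] at h1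
  have h2 : (Measure.map e volume).restrict (e '' Set.Icc 0 h)
      = (μH[1] : Measure (ℝ × ℝ)).restrict (e '' Set.Icc 0 h) := by
    rw [h1, Measure.restrict_restrict_of_subset (Set.image_subset_range _ _)]
  rw [← h2, hm.restrict_map, Set.preimage_image_eq _ he.injective]

lemma haus_int {e : ℝ → ℝ × ℝ} (he : Isometry e) (h : ℝ) (f : ℝ × ℝ → ℝ) :
    ∫ z in e '' Set.Icc 0 h, f z ∂(μH[1]) = ∫ x, f (e x) ∂(MM h) := by
  have hm : MeasurableEmbedding e := he.isClosedEmbedding.measurableEmbedding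
  rw [haus_seg he, hm.integral_map, MM, ← integral_Icc_eq_integral_Ioo]

lemma haus_intble {e : ℝ → ℝ × ℝ} (he : Isometry e) {h : ℝ} {f : ℝ × ℝ → ℝ}
    (hf : ContinuousOn f (Set.Icc 0 h ×ˢ Set.Icc 0 h))
    (hs : ∀ t ∈ Set.Icc 0 h, e t ∈ Set.Icc 0 h ×ˢ Set.Icc 0 h) :
    IntegrableOn f (e '' Set.Icc 0 h) μH[1] := by
  have hm : MeasurableEmbedding e := he.isClosedEmbedding.measurableEmbedding
  rw [IntegrableOn, haus_seg he, hm.integrable_map_iff]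
  exact (hf.comp he.continuous.continuousOn hs).integrableOn_compact isCompact_Icc

lemma isoX (c : ℝ) : Isometry (fun x : ℝ => (x, c)) := by
  refine Isometry.of_dist_eq fun x y => ?_
  simp [Prod.dist_eq]

lemma isoY (c : ℝ) : Isometry (fun x : ℝ => (c, x)) := by
  refine Isometry.of_dist_eq fun x y => ?_
  simp [Prod.dist_eq]

lemma int_union_le {α : Type*} [MeasurableSpace α] {μ : Measure α} {f : α → ℝ} {s t : Set α}
    (h0 : ∀ z, 0 ≤ f z) (hs : IntegrableOn f s μ) (ht : IntegrableOn f t μ) :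
    ∫ z in s ∪ t, f z ∂μ ≤ (∫ z in s, f z ∂μ) + ∫ z in t, f z ∂μ := by
  rw [← integral_add_measure hs ht]
  exact integral_mono_measure (Measure.restrict_union_le _ _)
    (Filter.Eventually.of_forall h0) (Integrable.add_measure hs ht)

lemma Dat.bdry {h : ℝ} {v gx gy : ℝ × ℝ → ℝ} (D : Dat h v gx gy) :
    ∫ z in frontier (Set.Ioo (0 : ℝ) h ×ˢ Set.Ioo (0 : ℝ) h), v z ^ 2 ∂(μH[1]) ≤
      8 * h * ((∫ z, gx z ^ 2 ∂((MM h).prod (MM h)))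
      + ∫ z, gy z ^ 2 ∂((MM h).prod (MM h))) := by
  have hh := D.hh
  have m0 : (0 : ℝ) ∈ Set.Icc 0 h := ⟨le_rfl, hh.le⟩
  have mh : h ∈ Set.Icc 0 h := ⟨hh.le, le_rfl⟩
  have hfr : frontier (Set.Ioo (0 : ℝ) h ×ˢ Set.Ioo (0 : ℝ) h) ⊆
      (((fun x : ℝ => (x, (0:ℝ))) '' Set.Icc 0 h ∪ (fun x : ℝ => (x, h)) '' Set.Icc 0 h) ∪
      ((fun x : ℝ => ((0:ℝ), x)) '' Set.Icc 0 h ∪ (fun x : ℝ => (h, x)) '' Set.Icc 0 h)) := by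
    rw [frontier_prod_eq, closure_Ioo hh.ne, frontier_Ioo hh]
    rintro ⟨a, b⟩ (⟨ha, hb⟩ | ⟨ha, hb⟩)
    · left
      rcases hb with hb | hb
      · left; exact ⟨a, ha, by simp only at hb ⊢; rw [hb]⟩
      · right; exact ⟨a, ha, by simp only [Set.mem_singleton_iff] at hb ⊢; rw [hb]⟩
    · right
      rcases ha with hb | hb
      · left; exact ⟨b, ‹_›, by simp only at hb ⊢; rw [hb]⟩
      · right; exact ⟨b, ‹_›, by simp only [Set.mem_singleton_iff] at hb ⊢; rw [hb]⟩
  have c2 : ContinuousOn (fun z => v z ^ 2) (Set.Icc 0 h ×ˢ Set.Icc 0 h) := D.cv.pow 2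
  have j1 := haus_intble (isoX 0) c2 (fun t ht => ⟨ht, m0⟩)
  have j2 := haus_intble (isoX h) c2 (fun t ht => ⟨ht, mh⟩)
  have j3 := haus_intble (isoY 0) c2 (fun t ht => ⟨m0, ht⟩)
  have j4 := haus_intble (isoY h) c2 (fun t ht => ⟨mh, ht⟩)
  have n : ∀ z, 0 ≤ v z ^ 2 := fun z => sq_nonneg _
  have a1 := setIntegral_mono_set ((j1.union j2).union (j3.union j4))
    (Filter.Eventually.of_forall n) hfr.eventuallyLE
  have a2 := int_union_le n (j1.union j2) (j3.union j4)
  have a3 := int_union_le n j1 j2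
  have a4 := int_union_le n j3 j4
  rw [haus_int (isoX 0), haus_int (isoX h)] at a3
  rw [haus_int (isoY 0), haus_int (isoY h)] at a4
  have e1 := D.edge m0
  have e2 := D.edge mh
  have e3 := D.swap.edge m0
  have e4 := D.swap.edge mh
  rw [integral_prod_swap (fun z => gx z ^ 2), integral_prod_swap (fun z => gy z ^ 2)] at e3 e4
  simp only [Prod.swap_prod_mk] at e3 e4
  linarith

lemma proj_le {h : ℝ} {v w : ℝ × ℝ → ℝ} (cv : ContinuousOn v (Set.Icc 0 h ×ˢ Set.Icc 0 h))
    (cw : Continuous w) (ho : ∫ z, (v z - w z) * w z ∂((MM h).prod (MM h)) = 0) :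
    ∫ z, w z ^ 2 ∂((MM h).prod (MM h)) ≤ ∫ z, v z ^ 2 ∂((MM h).prod (MM h)) := by
  have i1 : Integrable (fun z => (v z - w z) * w z) ((MM h).prod (MM h)) :=
    int2 ((cv.sub cw.continuousOn).mul cw.continuousOn)
  have i2 : Integrable (fun z => w z ^ 2) ((MM h).prod (MM h)) := int2 (cw.pow 2).continuousOn
  have i3 : Integrable (fun z => v z ^ 2) ((MM h).prod (MM h)) := int2 (cv.pow 2)
  have : ∫ z, (w z ^ 2 + 2 * ((v z - w z) * w z)) ∂((MM h).prod (MM h)) ≤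
      ∫ z, v z ^ 2 ∂((MM h).prod (MM h)) := by
    apply integral_mono (i2.add (i1.const_mul _)) i3
    intro z
    change w z ^ 2 + 2 * ((v z - w z) * w z) ≤ v z ^ 2
    nlinarith [sq_nonneg (v z - w z)]
  rw [integral_add i2 (i1.const_mul _), integral_const_mul, ho] at this
  linarith

lemma evP_cont (q : MvPolynomial (Fin 2) ℝ) : Continuous (evP q) := by
  unfold evP
  refine (MvPolynomial.continuous_eval q).comp ?_
  refine continuous_pi fun i => ?_
  fin_cases i
  · exact continuous_fst
  · exact continuous_snd

/-- upper stability bound for the "projected" stabilization on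
square elements `K = (0,h)²`, for `C¹` functions with zero average over `K`:
`h⁻¹ ‖v‖²_{0,∂K} + h⁻² ‖Π⁰_{p-2} v‖²_{0,K} ≤ C |v|²_{1,K}`.
The boundary integral is with respect to the 1-dimensional Hausdorff measure. -/
theorem stmt_5 (p : ℕ) (hp : 1 ≤ p) :
    ∃ C : ℝ, 0 < C ∧ ∀ h : ℝ, 0 < h → ∀ v : ℝ × ℝ → ℝ,
      (∃ U : Set (ℝ × ℝ), IsOpen U ∧ Set.Icc ((0 : ℝ), (0 : ℝ)) (h, h) ⊆ U ∧
        ContDiffOn ℝ 1 v U) →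
      (∫ z in Set.Ioo (0 : ℝ) h ×ˢ Set.Ioo (0 : ℝ) h, v z) = 0 →
      ∀ vhat : MvPolynomial (Fin 2) ℝ,
        vhat ∈ polyLE ((p : ℤ) - 2) →
        (∀ m ∈ polyLE ((p : ℤ) - 2),
          (∫ z in Set.Ioo (0 : ℝ) h ×ˢ Set.Ioo (0 : ℝ) h,
            (v z - evP vhat z) * evP m z) = 0) →
        h⁻¹ * (∫ z in frontier (Set.Ioo (0 : ℝ) h ×ˢ Set.Ioo (0 : ℝ) h),
            (v z) ^ 2 ∂(μH[1])) +
          h⁻¹ ^ 2 * (∫ z in Set.Ioo (0 : ℝ) h ×ˢ Set.Ioo (0 : ℝ) h, (evP vhat z) ^ 2) ≤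
        C * ∫ z in Set.Ioo (0 : ℝ) h ×ˢ Set.Ioo (0 : ℝ) h, gradSq2 v z := by
  refine ⟨10, by norm_num, ?_⟩
  rintro h hh v ⟨U, hU, hKU, hv⟩ hmean vhat hvhat horth
  have hK : Set.Icc (0 : ℝ) h ×ˢ Set.Icc (0 : ℝ) h ⊆ U := by
    rw [Set.Icc_prod_Icc]; exact hKU
  have hdiff : ∀ z ∈ U, HasFDerivAt v (fderiv ℝ v z) z := fun z hz =>
    ((hv.contDiffAt (hU.mem_nhds hz)).differentiableAt one_ne_zero).hasFDerivAt
  have hcf : ContinuousOn (fderiv ℝ v) U := hv.continuousOn_fderiv_of_isOpen hU le_rfl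
  have dX : ∀ x y : ℝ, (x, y) ∈ U →
      HasDerivAt (fun t => v (t, y)) (fderiv ℝ v (x, y) (1, 0)) x := fun x y hz =>
    (hdiff _ hz).comp_hasDerivAt x ((hasDerivAt_id x).prodMk (hasDerivAt_const x y))
  have dY : ∀ x y : ℝ, (x, y) ∈ U →
      HasDerivAt (fun t => v (x, t)) (fderiv ℝ v (x, y) (0, 1)) y := fun x y hz =>
    (hdiff _ hz).comp_hasDerivAt y ((hasDerivAt_const y x).prodMk (hasDerivAt_id y))
  have D : Dat h v (fun z => fderiv ℝ v z (1, 0)) (fun z => fderiv ℝ v z (0, 1)) :=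
    { hh := hh
      cv := hv.continuousOn.mono hK
      cx := (hcf.mono hK).clm_apply continuousOn_const
      cy := (hcf.mono hK).clm_apply continuousOn_const
      dx := fun x hx y hy => dX x y (hK ⟨hx, hy⟩)
      dy := fun x hx y hy => dY x y (hK ⟨hx, hy⟩)
      mean := by rw [MM_prod]; exact hmean }
  have hG : ∫ z in Set.Ioo (0 : ℝ) h ×ˢ Set.Ioo (0 : ℝ) h, gradSq2 v z =
      (∫ z, (fderiv ℝ v z (1, 0)) ^ 2 ∂((MM h).prod (MM h)))
      + ∫ z, (fderiv ℝ v z (0, 1)) ^ 2 ∂((MM h).prod (MM h)) := by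
    have i1 : Integrable (fun z => (fderiv ℝ v z (1, 0)) ^ 2) ((MM h).prod (MM h)) :=
      int2 (D.cx.pow 2)
    have i2 : Integrable (fun z => (fderiv ℝ v z (0, 1)) ^ 2) ((MM h).prod (MM h)) :=
      int2 (D.cy.pow 2)
    rw [← integral_add i1 i2, MM_prod]
    refine setIntegral_congr_fun (measurableSet_Ioo.prod measurableSet_Ioo) ?_
    rintro ⟨a, b⟩ ⟨ha, hb⟩
    have hz := hK ⟨Set.Ioo_subset_Icc_self ha, Set.Ioo_subset_Icc_self hb⟩
    simp only [gradSq2]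
    rw [(dX a b hz).deriv, (dY a b hz).deriv]
  have ho := horth vhat hvhat
  rw [← MM_prod] at ho
  have h1 := proj_le D.cv (evP_cont vhat) ho
  have h2 := D.area
  have h3 := D.bdry
  rw [hG, ← MM_prod]
  set G := (∫ z, (fderiv ℝ v z (1, 0)) ^ 2 ∂((MM h).prod (MM h)))
      + ∫ z, (fderiv ℝ v z (0, 1)) ^ 2 ∂((MM h).prod (MM h))
  have k1 := mul_le_mul_of_nonneg_left h3 (inv_nonneg.2 hh.le)
  have k2 := mul_le_mul_of_nonneg_left (h1.trans h2) (sq_nonneg h⁻¹)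
  have r1 : h⁻¹ * (8 * h * G) = 8 * G := by field_simp
  have r2 : h⁻¹ ^ 2 * (2 * h ^ 2 * G) = 2 * G := by field_simp
  rw [r1] at k1
  rw [r2] at k2
  linarith
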